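/- Orthogonality of the correction to the ground state: let B : ℝ² × ℝ² → ℝ be a symmetric bilinear form, α ∈ ℝ², λ ∈ ℝ, and let c₀(α) ∈ ℝ² be given by c₀(α)ⱼ = ( ∫Q⁴ / (2∫Q²) ) B(eⱼ, α). Suppose T₂ : ℝ² → ℝ is a Schwartz function satisfying L₊T₂ = λ B(α, y) Q³ + (λ²/2) B(y, y) Q³ − λ (c₀(α)·y) Q on ℝ². Then ∫_{ℝ²} T₂(y) Q(y) dy = 0. -/

import Mathlib

open MeasureTheory

noncomputable section

abbrev E2 := EuclideanSpace ℝ (Fin 2)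

/-- Partial derivative in the `j`-th coordinate direction. -/
def pd (j : Fin 2) (f : E2 → ℝ) (y : E2) : ℝ :=
  fderiv ℝ f y (EuclideanSpace.single j 1)

/-- The Laplacian on `ℝ²`. -/
def lap (f : E2 → ℝ) (y : E2) : ℝ := ∑ j : Fin 2, pd j (pd j f) y

open LineDeriv SchwartzMap

/-- Partial derivative on Schwartz functions. -/
def sD (j : Fin 2) (f : SchwartzMap E2 ℝ) : SchwartzMap E2 ℝ :=
  ∂_{(EuclideanSpace.single j (1 : ℝ) : E2)} f

/-- Multiplication by a coordinate on Schwartz functions. -/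
def sX (k : Fin 2) (f : SchwartzMap E2 ℝ) : SchwartzMap E2 ℝ :=
  smulLeftCLM ℝ (fun y : E2 => y k) f

/-- Product of Schwartz functions. -/
def sM (f g : SchwartzMap E2 ℝ) : SchwartzMap E2 ℝ :=
  smulLeftCLM ℝ (fun y : E2 => f y) g

theorem sD_apply (j : Fin 2) (f : SchwartzMap E2 ℝ) (y : E2) :
    sD j f y = fderiv ℝ f y (EuclideanSpace.single j 1) := rfl

theorem sX_apply (k : Fin 2) (f : SchwartzMap E2 ℝ) (y : E2) : sX k f y = y k * f y := by
  have h : Function.HasTemperateGrowth (fun y : E2 => y k) :=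
    (EuclideanSpace.proj k : E2 →L[ℝ] ℝ).hasTemperateGrowth
  simp [sX, smulLeftCLM_apply_apply h]

theorem sM_apply (f g : SchwartzMap E2 ℝ) (y : E2) : sM f g y = f y * g y := by
  simp [sM, smulLeftCLM_apply_apply f.hasTemperateGrowth]

theorem lap_eq (f : SchwartzMap E2 ℝ) (y : E2) :
    lap (fun z => f z) y = sD 0 (sD 0 f) y + sD 1 (sD 1 f) y := by
  simp only [lap, Fin.sum_univ_two]
  rfl

theorem sD_add (j : Fin 2) (f g : SchwartzMap E2 ℝ) : sD j (f + g) = sD j f + sD j g :=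
  lineDerivOp_add _ _ _

theorem sD_smul (j : Fin 2) (c : ℝ) (f : SchwartzMap E2 ℝ) : sD j (c • f) = c • sD j f :=
  lineDerivOp_smul _ _ _

theorem sD_sub (j : Fin 2) (f g : SchwartzMap E2 ℝ) : sD j (f - g) = sD j f - sD j g := by
  rw [sub_eq_add_neg, sub_eq_add_neg, sD_add]
  congr 1
  exact lineDerivOp_neg _ _

theorem sD_comm (j k : Fin 2) (f : SchwartzMap E2 ℝ) : sD j (sD k f) = sD k (sD j f) := by
  have key : ∀ (j k : Fin 2) (y : E2), sD j (sD k f) y =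
      fderiv ℝ (fderiv ℝ f) y (EuclideanSpace.single j 1) (EuclideanSpace.single k 1) := by
    intro j k y
    have hd : DifferentiableAt ℝ (fderiv ℝ f) y :=
      (((f.smooth 2).fderiv_right (m := 1) (by norm_num)).differentiable (by norm_num)) y
    have h := (hd.hasFDerivAt.clm_apply
      (hasFDerivAt_const (EuclideanSpace.single k (1 : ℝ) : E2) y)).fderiv
    rw [sD_apply]
    change fderiv ℝ (fun z => fderiv ℝ f z (EuclideanSpace.single k 1)) y _ = _
    rw [h]
    simp
  ext y
  rw [key, key]
  exact ((f.smooth 2).contDiffAt.isSymmSndFDerivAt (by simp)) _ _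

theorem sD_sM (j : Fin 2) (f g : SchwartzMap E2 ℝ) :
    sD j (sM f g) = sM (sD j f) g + sM f (sD j g) := by
  ext y
  have h := ((f.hasFDerivAt y).mul (g.hasFDerivAt y)).fderiv
  have e : (sM f g : E2 → ℝ) = (f : E2 → ℝ) * g := by
    ext z; simp [sM_apply]
  rw [sD_apply, e, h]
  simp [sM_apply, sD_apply]
  ring

theorem sD_sX (j k : Fin 2) (f : SchwartzMap E2 ℝ) :
    sD j (sX k f) = (if k = j then (1 : ℝ) else 0) • f + sX k (sD j f) := by
  ext y
  have h := (((EuclideanSpace.proj k : E2 →L[ℝ] ℝ).hasFDerivAt (x := y)).mul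
    (f.hasFDerivAt y)).fderiv
  have e : (sX k f : E2 → ℝ) = ((EuclideanSpace.proj k : E2 →L[ℝ] ℝ) : E2 → ℝ) * f := by
    ext z; simp [sX_apply]
  rw [sD_apply, e, h]
  split_ifs with hkj <;> simp [sX_apply, sD_apply, hkj] <;> ring

theorem int_sD (j : Fin 2) (f : SchwartzMap E2 ℝ) : ∫ y : E2, sD j f y = 0 := by
  have h := integral_mul_fderiv_eq_neg_fderiv_mul_of_integrable (μ := (volume : Measure E2))
    (f := fun _ : E2 => (1 : ℝ)) (g := f) (v := EuclideanSpace.single j 1)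
    (by simp) (by simp only [one_mul]; exact (sD j f).integrable) (by simpa using f.integrable)
    (fun _ _ => differentiableAt_const _) (fun x _ => f.differentiableAt)
  simpa [sD_apply] using h

/-- The generator of scaling applied to `Q`. -/
def sP (Q : SchwartzMap E2 ℝ) : SchwartzMap E2 ℝ := Q + (sX 0 (sD 0 Q) + sX 1 (sD 1 Q))

theorem lap_sP (Q : SchwartzMap E2 ℝ)
    (hQeq : ∀ y, -lap (fun z => Q z) y + Q y = (Q y) ^ 3) (y : E2) :
    sD 0 (sD 0 (sP Q)) y + sD 1 (sD 1 (sP Q)) y =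
      sP Q y - 3 * Q y ^ 2 * sP Q y + 2 * Q y := by
  have hS : sD 0 (sD 0 Q) + sD 1 (sD 1 Q) = Q - sM Q (sM Q Q) := by
    ext z
    have := hQeq z
    rw [lap_eq] at this
    simp [sM_apply]
    linarith
  have h0 := congrArg (fun f => sD 0 f y) hS
  have h1 := congrArg (fun f => sD 1 f y) hS
  have hz := congrArg (fun f => f y) hS
  simp only [sD_add, sD_sub, sD_sM, SchwartzMap.add_apply, SchwartzMap.sub_apply, sM_apply]
    at h0 h1 hz
  have c1 : sD 1 (sD 1 (sD 0 Q)) = sD 0 (sD 1 (sD 1 Q)) := by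
    rw [sD_comm 1 0 Q, sD_comm 1 0 (sD 1 Q)]
  have c2 : sD 0 (sD 0 (sD 1 Q)) = sD 1 (sD 0 (sD 0 Q)) := by
    rw [sD_comm 0 1 Q, sD_comm 0 1 (sD 0 Q)]
  simp [sP, sD_add, sD_sX, sX_apply, sD_smul, c1, c2]
  linear_combination (y 0) * h0 + (y 1) * h1 + 3 * hz

theorem int_green (f g : SchwartzMap E2 ℝ) (j : Fin 2) :
    ∫ y : E2, (sM f (sD j (sD j g)) - sM g (sD j (sD j f))) y = 0 := by
  have : sM f (sD j (sD j g)) - sM g (sD j (sD j f))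
      = sD j (sM f (sD j g) - sM g (sD j f)) := by
    rw [sD_sub, sD_sM, sD_sM]
    ext y
    simp [sM_apply]
    ring
  rw [this]
  exact int_sD _ _

theorem sD_neg (Q : SchwartzMap E2 ℝ) (hev : ∀ y, Q (-y) = Q y) (j : Fin 2) (y : E2) :
    sD j Q (-y) = - sD j Q y := by
  have h := ((Q.hasFDerivAt (-y)).comp y (hasFDerivAt_id y).neg).fderiv
  have e : (Q : E2 → ℝ) ∘ Neg.neg = (Q : E2 → ℝ) := funext hev
  rw [e] at h
  rw [sD_apply, sD_apply, h]
  simp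

/-- The vector fields whose divergence is used. -/
def sW (a b c : ℝ) (Q : SchwartzMap E2 ℝ) (k : Fin 2) : SchwartzMap E2 ℝ :=
  let M := sM Q (sM Q (sM Q Q))
  sX k (a • sX 0 (sX 0 M) + (2 * b) • sX 0 (sX 1 M) + c • sX 1 (sX 1 M))

theorem div_sW (a b c : ℝ) (Q : SchwartzMap E2 ℝ) (y : E2) :
    sD 0 (sW a b c Q 0) y + sD 1 (sW a b c Q 1) y =
      4 * ((a * y 0 ^ 2 + 2 * b * y 0 * y 1 + c * y 1 ^ 2) * Q y ^ 3 * sP Q y) := by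
  simp [sW, sP, sD_add, sD_sX, sX_apply, sD_smul, sD_sM, sM_apply]
  ring

theorem B_quad (B : E2 →ₗ[ℝ] E2 →ₗ[ℝ] ℝ) (hB : ∀ x y : E2, B x y = B y x) (y : E2) :
    B y y = B (EuclideanSpace.single 0 1) (EuclideanSpace.single 0 1) * y 0 ^ 2
      + 2 * B (EuclideanSpace.single 0 1) (EuclideanSpace.single 1 1) * y 0 * y 1
      + B (EuclideanSpace.single 1 1) (EuclideanSpace.single 1 1) * y 1 ^ 2 := by
  have e : y = y 0 • (EuclideanSpace.single 0 1 : E2) + y 1 • (EuclideanSpace.single 1 1 : E2) := by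
    ext i; fin_cases i <;> simp
  have h := hB (EuclideanSpace.single 1 1) (EuclideanSpace.single 0 1)
  conv_lhs => rw [e]
  simp only [map_add, map_smul, LinearMap.add_apply, LinearMap.smul_apply, smul_eq_mul]
  rw [h]
  ring

/-- If `T₂` solves `L₊T₂ = λB(α,y)Q³ + (λ²/2)B(y,y)Q³ − λ(c₀(α)·y)Q`, with
`c₀(α)ⱼ = (∫Q⁴/(2∫Q²)) B(eⱼ, α)`, then `⟨T₂, Q⟩ = 0`. -/
theorem stmt13 (Q : SchwartzMap E2 ℝ)
    (hQpos : ∀ y, 0 < Q y)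
    (hQrad : ∀ y z : E2, ‖y‖ = ‖z‖ → Q y = Q z)
    (hQeq : ∀ y, -lap (fun z => Q z) y + Q y = (Q y) ^ 3)
    (B : E2 →ₗ[ℝ] E2 →ₗ[ℝ] ℝ) (hB : ∀ x y : E2, B x y = B y x)
    (α : E2) (lam : ℝ) (T₂ : SchwartzMap E2 ℝ)
    (hT₂ : ∀ y : E2,
      -lap (fun z => T₂ z) y + T₂ y - 3 * (Q y) ^ 2 * T₂ y
        = lam * B α y * (Q y) ^ 3 + (lam ^ 2 / 2) * B y y * (Q y) ^ 3
          - lam * (∑ i : Fin 2,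
              ((∫ z : E2, (Q z) ^ 4) / (2 * ∫ z : E2, (Q z) ^ 2))
                * B (EuclideanSpace.single i 1) α * y i) * Q y) :
    ∫ y : E2, T₂ y * Q y = 0 := by
  have hev : ∀ y, Q (-y) = Q y := fun y => hQrad _ _ (norm_neg y)
  have hPev : ∀ y, sP Q (-y) = sP Q y := by
    intro y
    simp [sP, sX_apply, sD_neg Q hev, hev]
  set S : SchwartzMap E2 ℝ := (sM T₂ (sD 0 (sD 0 (sP Q))) - sM (sP Q) (sD 0 (sD 0 T₂)))
    + (sM T₂ (sD 1 (sD 1 (sP Q))) - sM (sP Q) (sD 1 (sD 1 T₂))) with hS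
  have hSint : ∫ y, S y = 0 := by
    have := integral_add (μ := (volume : Measure E2))
      (sM T₂ (sD 0 (sD 0 (sP Q))) - sM (sP Q) (sD 0 (sD 0 T₂))).integrable
      (sM T₂ (sD 1 (sD 1 (sP Q))) - sM (sP Q) (sD 1 (sD 1 T₂))).integrable
    rw [int_green, int_green, add_zero] at this
    exact this
  set G : SchwartzMap E2 ℝ := S - (2 : ℝ) • sM T₂ Q with hG
  have hGint : ∫ y, G y = - (2 * ∫ y, T₂ y * Q y) := by
    have h1 : ∀ y, G y = S y - 2 * sM T₂ Q y := fun y => by simp [hG]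
    simp_rw [h1]
    rw [integral_sub S.integrable ((sM T₂ Q).integrable.const_mul 2), hSint, integral_const_mul]
    simp [sM_apply]
  have hGneg : ∫ y, G (-y) = ∫ y, G y := integral_neg_eq_self (fun y => G y) volume
  have hGval : ∀ y, G y = sP Q y * (lam * B α y * (Q y) ^ 3 + (lam ^ 2 / 2) * B y y * (Q y) ^ 3
          - lam * (∑ i : Fin 2,
              ((∫ z : E2, (Q z) ^ 4) / (2 * ∫ z : E2, (Q z) ^ 2))
                * B (EuclideanSpace.single i 1) α * y i) * Q y) := by
    intro y
    rw [← hT₂ y, lap_eq]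
    have h := lap_sP Q hQeq y
    simp [hG, hS, sM_apply]
    linear_combination T₂ y * h
  set a := B (EuclideanSpace.single 0 1) (EuclideanSpace.single 0 1)
  set b := B (EuclideanSpace.single 0 1) (EuclideanSpace.single 1 1)
  set c := B (EuclideanSpace.single 1 1) (EuclideanSpace.single 1 1)
  have hsum : ∀ y, G y + G (-y) = lam ^ 2 / 4 *
      (sD 0 (sW a b c Q 0) y + sD 1 (sW a b c Q 1) y) := by
    intro y
    rw [hGval, hGval, div_sW, ← B_quad B hB y]
    simp only [hPev, hev, map_neg, LinearMap.neg_apply, Fin.sum_univ_two, PiLp.neg_apply]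
    ring
  have hGi : Integrable (fun y => G (-y)) := G.integrable.comp_neg
  have hfin : ∫ y, (G y + G (-y)) = 0 := by
    simp_rw [hsum]
    rw [integral_const_mul, integral_add (sD 0 _).integrable (sD 1 _).integrable, int_sD, int_sD]
    simp
  rw [integral_add G.integrable hGi, hGneg, hGint] at hfin
  linarith
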